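/- arXiv:1306.3362 — 3 statements merged into one kernel-verified Lean document; each statement's English description precedes it below -/
import Mathlib

section
/- There is a constant C_m ≥ 1 depending only on m with the following property. Let m, n ≥ 1 and p = (p_1,…,p_m) ∈ [1,∞]^m satisfy 1/p_1 + ⋯ + 1/p_m < 1 and, for every l ∈ {1,…,m}, Σ_{k≠l} 1/p_k ≤ 1/2. Set λ = 1/(1 − |1/p|). Then for every m-linear form A : ℓ_{p_1}^n × ⋯ × ℓ_{p_m}^n → ℂ and every k ∈ {1,…,m}, ( Σ_{i_k=1}^{n} ( Σ_{over all indices except i_k} |A(e_{i_1},…,e_{i_m})|² )^{λ/2} )^{1/λ} ≤ C_m ‖A‖. -/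
open scoped ENNReal NNReal

/-- The canonical unit vector `e_i` of `ℓ_p^n` (`ℂ^n` with the `ℓ_p` norm). -/
noncomputable def lpUnit (p : ℝ≥0∞) (n : ℕ) [Fact (1 ≤ p)] (i : Fin n) :
    PiLp p (fun _ : Fin n => ℂ) :=
  (WithLp.equiv p (Fin n → ℂ)).symm (Pi.single i 1)

theorem rpow_holder {ι : Type*} (s : Finset ι) (f g : ι → ℝ) (hf : ∀ i ∈ s, 0 ≤ f i)
    (hg : ∀ i ∈ s, 0 ≤ g i) (θ : ℝ) (h0 : 0 ≤ θ) (h1 : θ ≤ 1) :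
    ∑ i ∈ s, f i ^ θ * g i ^ (1 - θ) ≤ (∑ i ∈ s, f i) ^ θ * (∑ i ∈ s, g i) ^ (1 - θ) := by
  rcases h0.eq_or_lt with rfl | h0
  · simp
  rcases h1.eq_or_lt with rfl | h1
  · simp
  have hpq : (1 / θ).HolderConjugate (1 / (1 - θ)) := by
    rw [Real.holderConjugate_iff]
    refine ⟨by rw [lt_div_iff₀ h0]; linarith, by simp⟩
  have := Real.inner_le_Lp_mul_Lq_of_nonneg s hpq (f := fun i => f i ^ θ)
    (g := fun i => g i ^ (1 - θ)) (fun i hi => Real.rpow_nonneg (hf i hi) _)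
    (fun i hi => Real.rpow_nonneg (hg i hi) _)
  refine this.trans_eq ?_
  have hθ : (1 - θ) ≠ 0 := by linarith
  simp only [one_div, inv_inv]
  congr 2
  · exact Finset.sum_congr rfl fun i hi => Real.rpow_rpow_inv (hf i hi) h0.ne'
  · exact Finset.sum_congr rfl fun i hi => Real.rpow_rpow_inv (hg i hi) hθ

theorem sum_rpow_le_of_forall_weight {κ : Type*} [Fintype κ] (T : κ → ℝ) (hT : ∀ j, 0 ≤ T j)
    (α q C : ℝ) (hα : 0 < α) (hq : 0 ≤ q) (hC : 0 ≤ C)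
    (h : ∀ y : κ → ℝ, (∀ j, 0 ≤ y j) → ∑ j, y j ≤ 1 →
      ∑ j, (T j * y j ^ (2 * q)) ^ (1 / (2 * (α + q))) ≤ C ^ (1 / (α + q))) :
    ∑ j, T j ^ (1 / (2 * α)) ≤ C ^ (1 / α) := by
  set D := ∑ j, T j ^ (1 / (2 * α)) with hD
  have hD0 : 0 ≤ D := Finset.sum_nonneg fun j _ => Real.rpow_nonneg (hT j) _
  rcases hD0.eq_or_lt with h0 | hDp
  · rw [← h0]; positivity
  have hy0 : ∀ j, 0 ≤ T j ^ (1 / (2 * α)) / D := fun j =>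
    div_nonneg (Real.rpow_nonneg (hT j) _) hD0
  have key := h (fun j => T j ^ (1 / (2 * α)) / D) hy0
    (by rw [← Finset.sum_div, ← hD, div_self hDp.ne'])
  have hαq : 0 < α + q := by linarith
  have e : ∀ j, (T j * (T j ^ (1 / (2 * α)) / D) ^ (2 * q)) ^ (1 / (2 * (α + q)))
      = T j ^ (1 / (2 * α)) * D ^ (-(q / (α + q))) := by
    intro j
    rcases (hT j).eq_or_lt with h0 | hp
    · rw [← h0, zero_mul, Real.zero_rpow (by positivity), Real.zero_rpow (by positivity), zero_mul]
    · rw [Real.div_rpow (by positivity) hD0, ← Real.rpow_mul hp.le, div_eq_mul_inv,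
        ← Real.rpow_neg hD0, ← mul_assoc, ← Real.rpow_one_add' hp.le (by positivity),
        Real.mul_rpow (by positivity) (by positivity), ← Real.rpow_mul hp.le,
        ← Real.rpow_mul hD0]
      congr 2 <;> field_simp
  simp only [e] at key
  rw [← Finset.sum_mul, ← hD] at key
  have e2 : D * D ^ (-(q / (α + q))) = D ^ (α / (α + q)) := by
    rw [← Real.rpow_one_add' hD0]
    · congr 1; field_simp; ring
    · have : 1 + -(q / (α + q)) = α / (α + q) := by field_simp; ring
      rw [this]; positivity
  rw [e2] at key
  have := Real.rpow_le_rpow (by positivity) key (z := (α + q) / α) (by positivity)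
  rw [← Real.rpow_mul hD0, ← Real.rpow_mul hC] at this
  convert this using 2
  · rw [div_mul_div_cancel₀ hαq.ne', div_self hα.ne', Real.rpow_one]
  · field_simp

theorem sum_fiber_rpow_le {ω ι κ : Type*} [Fintype ω] [Fintype ι] [Fintype κ]
    [DecidableEq ι] [DecidableEq κ] (f : ω → ι) (g : ω → κ) (b : ω → ℝ) (hb : ∀ x, 0 ≤ b x)
    (α q C : ℝ) (hα : 1 / 2 ≤ α) (hq : 0 ≤ q) (hC : 0 ≤ C)
    (hf : ∀ y : κ → ℝ, (∀ j, 0 ≤ y j) → ∑ j, y j ≤ 1 →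
      ∑ i, (∑ x with f x = i, b x * y (g x) ^ (2 * q)) ^ (1 / (2 * (α + q))) ≤ C ^ (1 / (α + q)))
    (hg : ∑ j, (∑ x with g x = j, b x) ^ (1 / (2 * α)) ≤ C ^ (1 / α)) :
    ∑ i, (∑ x with f x = i, b x) ^ (1 / (2 * α)) ≤ C ^ (1 / α) := by
  have hα0 : 0 < α := by linarith
  have hαq : 0 < α + q := by linarith
  set T : κ → ℝ := fun j => ∑ x with g x = j, b x with hTdef
  have hT : ∀ j, 0 ≤ T j := fun j => Finset.sum_nonneg fun x _ => hb x
  have hbT : ∀ x, b x ≤ T (g x) := fun x =>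
    Finset.single_le_sum (f := b) (fun z _ => hb z) (by simp)
  set D := ∑ j, T j ^ (1 / (2 * α)) with hD
  have hD0 : 0 ≤ D := Finset.sum_nonneg fun j _ => Real.rpow_nonneg (hT j) _
  rcases hD0.eq_or_lt with h0 | hDp
  · have hT0 : ∀ j, T j = 0 := by
      intro j
      have := (Finset.sum_eq_zero_iff_of_nonneg
        (fun j _ => Real.rpow_nonneg (hT j) (1 / (2 * α)))).1 (hD.symm.trans h0.symm) j (by simp)
      exact ((Real.rpow_eq_zero (hT j) (by positivity)).1 this)
    have hb0 : ∀ x, b x = 0 := fun x => le_antisymm ((hbT x).trans (hT0 _).le) (hb x)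
    simp only [hb0, Finset.sum_const_zero]
    rw [Real.zero_rpow (by positivity)]
    simp only [Finset.sum_const_zero]
    positivity
  set y : κ → ℝ := fun j => T j ^ (1 / (2 * α)) / D with hy
  have hy0 : ∀ j, 0 ≤ y j := fun j => div_nonneg (Real.rpow_nonneg (hT j) _) hD0
  have hU := hf y hy0 (by rw [← Finset.sum_div, ← hD, div_self hDp.ne'])
  set U : ι → ℝ := fun i => ∑ x with f x = i, b x * y (g x) ^ (2 * q) with hUdef
  set V : ι → ℝ := fun i => ∑ x with f x = i, b x * y (g x) ^ (1 - 2 * α) with hVdef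
  have hU0 : ∀ i, 0 ≤ U i := fun i => Finset.sum_nonneg fun x _ =>
    mul_nonneg (hb x) (Real.rpow_nonneg (hy0 _) _)
  have hV0 : ∀ i, 0 ≤ V i := fun i => Finset.sum_nonneg fun x _ =>
    mul_nonneg (hb x) (Real.rpow_nonneg (hy0 _) _)
  have hV : ∑ i, V i ≤ C ^ (2 : ℝ) := by
    have e1 : ∑ i, V i = ∑ j, T j * y j ^ (1 - 2 * α) := by
      simp only [hVdef, hTdef]
      rw [Finset.sum_fiberwise, ← Finset.sum_fiberwise Finset.univ g]
      refine Finset.sum_congr rfl fun j _ => ?_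
      rw [Finset.sum_mul]
      refine Finset.sum_congr rfl fun x hx => ?_
      rw [(Finset.mem_filter.1 hx).2]
    have e2 : ∀ j, T j * y j ^ (1 - 2 * α) = T j ^ (1 / (2 * α)) * D ^ (2 * α - 1) := by
      intro j
      rcases (hT j).eq_or_lt with h0 | hp
      · rw [← h0, zero_mul, Real.zero_rpow (by positivity), zero_mul]
      · simp only [hy]
        rw [Real.div_rpow (by positivity) hD0, ← Real.rpow_mul hp.le, div_eq_mul_inv,
          ← Real.rpow_neg hD0, ← mul_assoc]
        nth_rewrite 1 [← Real.rpow_one (T j)]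
        rw [← Real.rpow_add hp]
        congr 2
        · field_simp; ring
        · ring
    rw [e1, Finset.sum_congr rfl fun j _ => e2 j, ← Finset.sum_mul, ← hD,
      ← Real.rpow_one_add' hD0 (by linarith)]
    have := Real.rpow_le_rpow hD0 hg (z := 2 * α) (by positivity)
    rw [← Real.rpow_mul hC] at this
    convert this using 2
    · ring
    · field_simp
  obtain ⟨θ, hθ0, hθ1, hθ⟩ : ∃ θ : ℝ, 0 ≤ θ ∧ θ ≤ 1 ∧ θ * q = (1 - θ) * (α - 1 / 2) := by
    rcases (show 0 ≤ q + (α - 1 / 2) by linarith).eq_or_lt with h | h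
    · refine ⟨0, le_rfl, zero_le_one, ?_⟩
      linarith
    · refine ⟨(α - 1 / 2) / (q + (α - 1 / 2)), div_nonneg (by linarith) h.le,
        (div_le_one h).2 (by linarith), ?_⟩
      have : 1 - (α - 1 / 2) / (q + (α - 1 / 2)) = q / (q + (α - 1 / 2)) := by
        rw [eq_div_iff h.ne', sub_mul, div_mul_cancel₀ _ h.ne']; ring
      rw [this]
      ring
  have hS : ∀ i, ∑ x with f x = i, b x ≤ U i ^ θ * V i ^ (1 - θ) := by
    intro i
    refine le_trans (Finset.sum_le_sum fun x _ => ?_) (rpow_holder _ _ _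
      (fun x _ => mul_nonneg (hb x) (Real.rpow_nonneg (hy0 _) _))
      (fun x _ => mul_nonneg (hb x) (Real.rpow_nonneg (hy0 _) _)) θ hθ0 hθ1)
    rcases (hb x).eq_or_lt with h0 | hp
    · rw [← h0]; simp only [zero_mul]; positivity
    · have hyp : 0 < y (g x) := by
        have := hp.trans_le (hbT x)
        simp only [hy]; positivity
      rw [Real.mul_rpow hp.le (by positivity), Real.mul_rpow hp.le (by positivity),
        mul_mul_mul_comm, ← Real.rpow_add hp, ← Real.rpow_mul hyp.le, ← Real.rpow_mul hyp.le,
        ← Real.rpow_add hyp]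
      have e1 : θ + (1 - θ) = 1 := by ring
      have e2 : 2 * q * θ + (1 - 2 * α) * (1 - θ) = 0 := by linear_combination 2 * hθ
      rw [e1, e2]; simp
  set τ := θ * (α + q) / α with hτ
  have hτ1 : 1 - τ = (1 - θ) / (2 * α) := by
    rw [hτ]; field_simp; linear_combination (-2) * hθ
  have hτ0 : 0 ≤ τ := by positivity
  have hτ1' : τ ≤ 1 := by
    have : 0 ≤ 1 - τ := by rw [hτ1]; exact div_nonneg (by linarith) (by linarith)
    linarith
  have hS2 : ∀ i, (∑ x with f x = i, b x) ^ (1 / (2 * α)) ≤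
      (U i ^ (1 / (2 * (α + q)))) ^ τ * V i ^ (1 - τ) := by
    intro i
    refine (Real.rpow_le_rpow (Finset.sum_nonneg fun x _ => hb x) (hS i) (by positivity)).trans_eq ?_
    have := hU0 i
    have := hV0 i
    rw [Real.mul_rpow (by positivity) (by positivity), ← Real.rpow_mul (hU0 i),
      ← Real.rpow_mul (hV0 i), ← Real.rpow_mul (hU0 i), hτ1, hτ]
    congr 2 <;> field_simp
  calc _ ≤ ∑ i, (U i ^ (1 / (2 * (α + q)))) ^ τ * V i ^ (1 - τ) :=
        Finset.sum_le_sum fun i _ => hS2 i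
    _ ≤ (∑ i, U i ^ (1 / (2 * (α + q)))) ^ τ * (∑ i, V i) ^ (1 - τ) :=
        rpow_holder _ _ _ (fun i _ => Real.rpow_nonneg (hU0 i) _) (fun i _ => hV0 i) τ hτ0 hτ1'
    _ ≤ (C ^ (1 / (α + q))) ^ τ * (C ^ (2 : ℝ)) ^ (1 - τ) := by
        have := Finset.sum_nonneg fun i (_ : i ∈ Finset.univ) => hV0 i
        have := Finset.sum_nonneg fun i (_ : i ∈ Finset.univ) =>
          Real.rpow_nonneg (hU0 i) (1 / (2 * (α + q)))
        have : 0 ≤ 1 - τ := by linarith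
        gcongr
    _ = C ^ (1 / α) := by
        rw [← Real.rpow_mul hC, ← Real.rpow_mul hC, ← Real.rpow_add_of_nonneg hC (by positivity)
          (mul_nonneg zero_le_two (by linarith))]
        congr 1
        rw [hτ1, hτ]; field_simp; ring


/-- The sign `±1` attached to a Boolean. -/
noncomputable def boolSign (b : Bool) : ℂ := if b then 1 else -1

theorem norm_boolSign (b : Bool) : ‖boolSign b‖ = 1 := by
  cases b <;> simp [boolSign]

theorem sum_signs_succ {M : Type*} [AddCommMonoid M] (n : ℕ) (F : (Fin (n + 1) → Bool) → M) :
    ∑ ε, F ε = ∑ ε : Fin n → Bool, (F (Fin.cons true ε) + F (Fin.cons false ε)) := by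
  rw [← (Fin.consEquiv fun _ : Fin (n + 1) => Bool).sum_comp, Fintype.sum_prod_type]
  simp [Fin.consEquiv, Finset.sum_add_distrib]

section

variable {E : Type*} [NormedAddCommGroup E] [InnerProductSpace ℂ E]

theorem signs_succ (n : ℕ) (v : Fin (n + 1) → E) (b : Bool) (ε : Fin n → Bool) :
    ∑ i, boolSign ((Fin.cons b ε : Fin (n + 1) → Bool) i) • v i
      = (∑ i, boolSign (ε i) • v i.succ) + boolSign b • v 0 := by
  rw [Fin.sum_univ_succ, add_comm]; simp

theorem sum_signs_norm_sq (n : ℕ) (v : Fin n → E) :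
    ∑ ε : Fin n → Bool, ‖∑ i, boolSign (ε i) • v i‖ ^ 2 = 2 ^ n * ∑ i, ‖v i‖ ^ 2 := by
  induction n with
  | zero => simp
  | succ n ih =>
    have h : ∀ s w : E, ‖s + w‖ ^ 2 + ‖s - w‖ ^ 2 = 2 * ‖s‖ ^ 2 + 2 * ‖w‖ ^ 2 := fun s w => by
      have := parallelogram_law_with_norm ℂ s w
      nlinarith
    rw [sum_signs_succ, Fin.sum_univ_succ]
    simp only [signs_succ]
    simp only [boolSign, if_true, Bool.false_eq_true, if_false, one_smul, neg_smul, ← sub_eq_add_neg]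
    simp only [h, Finset.sum_add_distrib, ← Finset.mul_sum]
    have := ih fun i => v i.succ
    simp only [boolSign] at this
    rw [this]
    simp
    ring

theorem norm_add_pow_four_add_norm_sub_pow_four_le (s w : E) :
    ‖s + w‖ ^ 4 + ‖s - w‖ ^ 4 ≤ 2 * ‖s‖ ^ 4 + 12 * ‖w‖ ^ 2 * ‖s‖ ^ 2 + 2 * ‖w‖ ^ 4 := by
  have h1 := parallelogram_law_with_norm ℂ s w
  have h2 := norm_add_le s w
  have h3 := norm_sub_le s w
  have h4 := abs_norm_sub_norm_le s w
  have h5 : |‖s‖ - ‖w‖| ≤ ‖s + w‖ := by simpa using abs_norm_sub_norm_le s (-w)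
  have a1 := norm_nonneg s
  have a2 := norm_nonneg w
  have b1 : ‖s + w‖ ^ 2 ≤ (‖s‖ + ‖w‖) ^ 2 := pow_le_pow_left₀ (norm_nonneg _) h2 2
  have b2 : ‖s - w‖ ^ 2 ≤ (‖s‖ + ‖w‖) ^ 2 := pow_le_pow_left₀ (norm_nonneg _) h3 2
  have b3 : (‖s‖ - ‖w‖) ^ 2 ≤ ‖s - w‖ ^ 2 := by
    rw [← sq_abs]; exact pow_le_pow_left₀ (abs_nonneg _) h4 2
  have b4 : (‖s‖ - ‖w‖) ^ 2 ≤ ‖s + w‖ ^ 2 := by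
    rw [← sq_abs]; exact pow_le_pow_left₀ (abs_nonneg _) h5 2
  have c : (‖s + w‖ ^ 2 - ‖s - w‖ ^ 2) ^ 2 ≤ (4 * ‖s‖ * ‖w‖) ^ 2 := by
    apply sq_le_sq'
    · nlinarith
    · nlinarith
  have d : ‖s + w‖ ^ 2 + ‖s - w‖ ^ 2 = 2 * (‖s‖ ^ 2 + ‖w‖ ^ 2) := by nlinarith
  have e : (‖s + w‖ ^ 2 + ‖s - w‖ ^ 2) ^ 2 = 4 * (‖s‖ ^ 2 + ‖w‖ ^ 2) ^ 2 := by rw [d]; ring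
  nlinarith

theorem sum_signs_norm_pow_four_le (n : ℕ) (v : Fin n → E) :
    ∑ ε : Fin n → Bool, ‖∑ i, boolSign (ε i) • v i‖ ^ 4
      ≤ 2 ^ n * (3 * (∑ i, ‖v i‖ ^ 2) ^ 2) := by
  induction n with
  | zero => simp
  | succ n ih =>
    rw [sum_signs_succ, Fin.sum_univ_succ]
    simp only [signs_succ]
    simp only [boolSign, if_true, Bool.false_eq_true, if_false, one_smul, neg_smul, ← sub_eq_add_neg]
    refine (Finset.sum_le_sum fun ε _ => norm_add_pow_four_add_norm_sub_pow_four_le _ _).trans ?_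
    simp only [Finset.sum_add_distrib, ← Finset.mul_sum]
    have h4 := ih fun i => v i.succ
    have h2 := sum_signs_norm_sq n fun i => v i.succ
    simp only [boolSign] at h4 h2
    rw [h2]
    simp only [Finset.sum_const, Finset.card_univ, Fintype.card_fun, Fintype.card_bool,
      Fintype.card_fin, nsmul_eq_mul, Nat.cast_pow, Nat.cast_ofNat]
    have h0 : (0 : ℝ) ≤ 2 ^ n * ‖v 0‖ ^ 4 := by positivity
    rw [pow_succ (2 : ℝ) n]
    nlinarith

/-- Khinchin's inequality between `L_1` and `L_2` for Hilbert space valued Rademacher sums. -/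
theorem sqrt_sum_norm_sq_le_sum_signs (n : ℕ) (v : Fin n → E) :
    2 ^ n * √(∑ i, ‖v i‖ ^ 2) ≤ 2 * ∑ ε : Fin n → Bool, ‖∑ i, boolSign (ε i) • v i‖ := by
  set σ := √(∑ i, ‖v i‖ ^ 2) with hσ
  have hs : σ ^ 2 = ∑ i, ‖v i‖ ^ 2 := Real.sq_sqrt (by positivity)
  have hσ0 : 0 ≤ σ := Real.sqrt_nonneg _
  rcases hσ0.eq_or_lt with h0 | hp
  · rw [← h0, mul_zero]; positivity
  have h2 := sum_signs_norm_sq n v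
  have h4 := sum_signs_norm_pow_four_le n v
  rw [← hs] at h2 h4
  have key : ∀ t : ℝ, 0 ≤ t → 12 * σ ^ 2 * t ^ 2 - t ^ 4 ≤ 16 * σ ^ 3 * t := fun t ht => by
    nlinarith [mul_nonneg ht (mul_nonneg (add_nonneg ht (mul_nonneg zero_le_four hp.le))
      (sq_nonneg (t - 2 * σ)))]
  have h := Finset.sum_le_sum fun (ε : Fin n → Bool) (_ : ε ∈ Finset.univ) =>
    key ‖∑ i, boolSign (ε i) • v i‖ (norm_nonneg _)
  simp only [Finset.sum_sub_distrib, ← Finset.mul_sum] at h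
  rw [h2] at h
  have h6 : σ ^ 3 * (9 * (2 ^ n * σ)) ≤
      σ ^ 3 * (16 * ∑ ε : Fin n → Bool, ‖∑ i, boolSign (ε i) • v i‖) := by nlinarith
  have h7 := le_of_mul_le_mul_left h6 (by positivity)
  have : 0 < 2 ^ n * σ := by positivity
  linarith

end

theorem exists_signs_sum_sqrt_le {N κ : Type*} [Fintype N] [Fintype κ] (n : ℕ)
    (a : N → κ → Fin n → ℂ) :
    ∃ ε : Fin n → ℂ, (∀ i, ‖ε i‖ = 1) ∧
      ∑ l, √(∑ x, ∑ i, ‖a l x i‖ ^ 2) ≤ 2 * ∑ l, √(∑ x, ‖∑ i, ε i * a l x i‖ ^ 2) := by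
  let v : N → Fin n → EuclideanSpace ℂ κ := fun l i => WithLp.toLp 2 fun x => a l x i
  have h1 : ∀ l, ∑ i, ‖v l i‖ ^ 2 = ∑ x, ∑ i, ‖a l x i‖ ^ 2 := fun l => by
    rw [Finset.sum_comm]
    exact Finset.sum_congr rfl fun i _ => EuclideanSpace.norm_sq_eq _
  have h2 : ∀ l (ε : Fin n → ℂ), ‖∑ i, ε i • v l i‖ = √(∑ x, ‖∑ i, ε i * a l x i‖ ^ 2) := by
    intro l ε
    rw [EuclideanSpace.norm_eq]
    simp [v]
  have h3 : ∑ ε : Fin n → Bool, ∑ l, √(∑ x, ∑ i, ‖a l x i‖ ^ 2) ≤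
      ∑ ε : Fin n → Bool, 2 * ∑ l, √(∑ x, ‖∑ i, boolSign (ε i) * a l x i‖ ^ 2) := by
    simp only [← h2 _ fun i => boolSign (_ : Bool), ← h1]
    rw [← Finset.mul_sum, Finset.sum_comm, Finset.sum_comm (s := Finset.univ (α := Fin n → Bool)),
      Finset.mul_sum]
    refine Finset.sum_le_sum fun l _ => ?_
    have := sqrt_sum_norm_sq_le_sum_signs n (v l)
    simpa using this
  obtain ⟨ε, -, hε⟩ := Finset.exists_le_of_sum_le Finset.univ_nonempty h3
  exact ⟨fun i => boolSign (ε i), fun i => norm_boolSign _, hε⟩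

/-- A multilinear version of Khinchin's inequality. -/
theorem exists_signs_multilinear {N : Type*} [Fintype N] (n m : ℕ)
    (a : N → (Fin m → Fin n) → ℂ) :
    ∃ ε : Fin m → Fin n → ℂ, (∀ j i, ‖ε j i‖ = 1) ∧
      ∑ l, √(∑ x, ‖a l x‖ ^ 2) ≤ 2 ^ m * ∑ l, ‖∑ x, a l x * ∏ j, ε j (x j)‖ := by
  induction m with
  | zero =>
    refine ⟨fun _ _ => 1, by simp, ?_⟩
    simp [Real.sqrt_sq]
  | succ m ih =>
    obtain ⟨e, he, h⟩ := exists_signs_sum_sqrt_le n fun l (x : Fin m → Fin n) i =>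
      a l (Fin.cons i x)
    obtain ⟨ε, hε, h'⟩ := ih fun l x => ∑ i, e i * a l (Fin.cons i x)
    refine ⟨Fin.cons e ε, fun j => ?_, ?_⟩
    · refine Fin.cases ?_ (fun j => ?_) j
      · simpa using he
      · simpa using hε j
    · have hsum : ∀ {M : Type} [AddCommMonoid M] (F : (Fin (m + 1) → Fin n) → M),
          ∑ x, F x = ∑ x : Fin m → Fin n, ∑ i, F (Fin.cons i x) := by
        intro M _ F
        rw [← (Fin.consEquiv fun _ : Fin (m + 1) => Fin n).sum_comp, Fintype.sum_prod_type,
          Finset.sum_comm]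
        simp [Fin.consEquiv]
      simp only [hsum]
      refine h.trans ?_
      rw [pow_succ', mul_assoc]
      refine mul_le_mul_of_nonneg_left (h'.trans_eq ?_) zero_le_two
      congr 1
      refine Finset.sum_congr rfl fun l _ => ?_
      congr 1
      refine Finset.sum_congr rfl fun x _ => ?_
      rw [Finset.sum_mul]
      refine Finset.sum_congr rfl fun i _ => ?_
      simp [Fin.prod_univ_succ]
      ring

theorem lpUnit_apply (p : ℝ≥0∞) (n : ℕ) [Fact (1 ≤ p)] (i j : Fin n) :
    lpUnit p n i j = if j = i then 1 else 0 := by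
  simp [lpUnit]

theorem apply_eq_sum_lpUnit {m n : ℕ} (p : Fin m → ℝ≥0∞) [∀ k, Fact (1 ≤ p k)]
    (A : ContinuousMultilinearMap ℂ (fun k => PiLp (p k) (fun _ : Fin n => ℂ)) ℂ)
    (z : Fin m → Fin n → ℂ) :
    A (fun j => WithLp.toLp (p j) (z j)) =
      ∑ x : Fin m → Fin n, A (fun j => lpUnit (p j) n (x j)) * ∏ j, z j (x j) := by
  have h : ∀ j, WithLp.toLp (p j) (z j) = ∑ i, z j i • lpUnit (p j) n i := by
    intro j
    ext l
    simp [lpUnit_apply]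
  simp only [h]
  rw [A.map_sum]
  refine Finset.sum_congr rfl fun x _ => ?_
  rw [A.map_smul_univ, smul_eq_mul, mul_comm]

theorem norm_toLp_le_one {n : ℕ} (p : ℝ≥0∞) [Fact (1 ≤ p)] (y : Fin n → ℝ) (hy : ∀ i, 0 ≤ y i)
    (hy1 : ∑ i, y i ≤ 1) (z : Fin n → ℂ) (hz : ∀ i, ‖z i‖ = y i ^ (p⁻¹).toReal) :
    ‖WithLp.toLp p z‖ ≤ 1 := by
  have h1 : 1 ≤ p := Fact.out
  rcases eq_or_ne p ∞ with rfl | hp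
  · rw [PiLp.norm_toLp, pi_norm_le_iff_of_nonneg zero_le_one]
    intro i
    simp [hz]
  · have hp0 : 0 < p.toReal := ENNReal.toReal_pos (by positivity) hp
    rw [PiLp.norm_eq_sum hp0]
    refine Real.rpow_le_one (by positivity) ?_ (by positivity)
    refine le_trans (le_of_eq (Finset.sum_congr rfl fun i _ => ?_)) hy1
    simp only [hz]
    rw [ENNReal.toReal_inv, ← Real.rpow_mul (hy i), inv_mul_cancel₀ hp0.ne', Real.rpow_one]

theorem sum_sqrt_weighted_le {m n : ℕ} (p : Fin m → ℝ≥0∞) [∀ k, Fact (1 ≤ p k)]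
    (A : ContinuousMultilinearMap ℂ (fun k => PiLp (p k) (fun _ : Fin n => ℂ)) ℂ) (k : Fin m)
    (y : Fin m → Fin n → ℝ) (hy : ∀ j i, 0 ≤ y j i) (hy1 : ∀ j, ∑ i, y j i ≤ 1) :
    ∑ i, √(∑ x : Fin m → Fin n with x k = i, ‖A (fun j => lpUnit (p j) n (x j))‖ ^ 2 *
        ∏ j, y j (x j) ^ (2 * ((p j)⁻¹).toReal)) ≤ 2 ^ m * ‖A‖ := by
  set a : (Fin m → Fin n) → ℂ := fun x => A (fun j => lpUnit (p j) n (x j)) with ha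
  set w : Fin m → Fin n → ℝ := fun j i => y j i ^ ((p j)⁻¹).toReal with hw
  have hw0 : ∀ j i, 0 ≤ w j i := fun j i => Real.rpow_nonneg (hy j i) _
  obtain ⟨ε, hε, h⟩ := exists_signs_multilinear n m fun (i : Fin n) (x : Fin m → Fin n) =>
    if x k = i then a x * ∏ j, (w j (x j) : ℂ) else 0
  have hL : ∀ i, ∑ x : Fin m → Fin n with x k = i, ‖a x‖ ^ 2 * ∏ j, y j (x j) ^ (2 * ((p j)⁻¹).toReal) =
      ∑ x, ‖if x k = i then a x * ∏ j, (w j (x j) : ℂ) else 0‖ ^ 2 := by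
    intro i
    rw [Finset.sum_filter]
    refine Finset.sum_congr rfl fun x _ => ?_
    split_ifs
    · rw [norm_mul, mul_pow, norm_prod, ← Finset.prod_pow]
      congr 1
      refine Finset.prod_congr rfl fun j _ => ?_
      rw [Complex.norm_real, Real.norm_of_nonneg (hw0 _ _), mul_comm, Real.rpow_mul (hy _ _),
        Real.rpow_two]
    · simp
  rw [Finset.sum_congr rfl fun i _ => congrArg Real.sqrt (hL i)]
  refine h.trans (mul_le_mul_of_nonneg_left ?_ (by positivity))
  set G : Fin n → ℂ := fun i => ∑ x, (if x k = i then a x * ∏ j, (w j (x j) : ℂ) else 0) *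
    ∏ j, ε j (x j) with hG
  have hc : ∀ i, ∃ c : ℂ, ‖c‖ = 1 ∧ c * G i = ‖G i‖ := fun i => by
    rcases eq_or_ne (G i) 0 with h0 | h0
    · exact ⟨1, by simp, by simp [h0]⟩
    · have : (‖G i‖ : ℂ) ≠ 0 := by simpa using h0
      exact ⟨‖G i‖ / G i, by simp [h0], by field_simp⟩
  choose c hc1 hc2 using hc
  let z : Fin m → Fin n → ℂ := fun j i => (w j i * ε j i) * if j = k then c i else 1
  have hz : ∀ j, ‖WithLp.toLp (p j) (z j)‖ ≤ 1 := fun j => by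
    refine norm_toLp_le_one (p j) (y j) (hy j) (hy1 j) _ fun i => ?_
    have : ‖if j = k then c i else 1‖ = 1 := by split_ifs <;> simp [hc1]
    simp only [z, norm_mul, this, hε, Complex.norm_real, Real.norm_of_nonneg (hw0 _ _), mul_one]
    rfl
  have hsum : ((∑ i, ‖G i‖ : ℝ) : ℂ) = A fun j => WithLp.toLp (p j) (z j) := by
    push_cast
    rw [apply_eq_sum_lpUnit, Finset.sum_congr rfl fun i _ => (hc2 i).symm]
    simp only [hG, Finset.mul_sum]
    rw [Finset.sum_comm]
    refine Finset.sum_congr rfl fun x _ => ?_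
    have hz' : ∏ j, z j (x j) = (∏ j, (w j (x j) : ℂ)) * (∏ j, ε j (x j)) * c (x k) := by
      simp only [z, Finset.prod_mul_distrib]
      rw [Finset.prod_ite_eq' Finset.univ k fun j => c (x j), if_pos (Finset.mem_univ k)]
    have ht : ∀ i ≠ x k, c i * ((if x k = i then a x * ∏ j, (w j (x j) : ℂ) else 0) *
        ∏ j, ε j (x j)) = 0 := fun i hi => by simp [hi.symm]
    rw [Fintype.sum_eq_single (x k) ht, if_pos rfl, hz']
    ring
  have h0 : 0 ≤ ∑ i, ‖G i‖ := by positivity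
  calc ∑ i, ‖G i‖ = ‖((∑ i, ‖G i‖ : ℝ) : ℂ)‖ := by
        rw [Complex.norm_real, Real.norm_of_nonneg h0]
    _ ≤ ‖A‖ * ∏ j, ‖WithLp.toLp (p j) (z j)‖ := by rw [hsum]; exact A.le_opNorm _
    _ ≤ ‖A‖ * 1 := by
        gcongr
        exact Finset.prod_le_one (fun _ _ => norm_nonneg _) fun j _ => hz j
    _ = ‖A‖ := mul_one _

theorem sum_fiber_rpow_le_of_forall_weight {ω κ : Type*} [Fintype ω] [Fintype κ] [DecidableEq κ]
    (g : ω → κ) (b : ω → ℝ) (hb : ∀ x, 0 ≤ b x) (α q C : ℝ) (hα : 0 < α) (hq : 0 ≤ q) (hC : 0 ≤ C)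
    (h : ∀ y : κ → ℝ, (∀ j, 0 ≤ y j) → ∑ j, y j ≤ 1 →
      ∑ j, (∑ x with g x = j, b x * y (g x) ^ (2 * q)) ^ (1 / (2 * (α + q))) ≤
        C ^ (1 / (α + q))) :
    ∑ j, (∑ x with g x = j, b x) ^ (1 / (2 * α)) ≤ C ^ (1 / α) := by
  refine sum_rpow_le_of_forall_weight _ (fun j => Finset.sum_nonneg fun x _ => hb x) α q C hα hq hC
    fun y hy hy1 => ?_
  convert h y hy hy1 using 3 with j
  rw [Finset.sum_mul]
  refine Finset.sum_congr rfl fun x hx => ?_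
  rw [(Finset.mem_filter.1 hx).2]

theorem weight_mul_update {m n : ℕ} (q : Fin m → ℝ) (S : Finset (Fin m)) (s : Fin m) (hs : s ∉ S)
    (y : Fin m → Fin n → ℝ) (u : Fin n → ℝ) (x : Fin m → Fin n) :
    ∏ j ∈ Sᶜ, Function.update y s u j (x j) ^ (2 * q j) =
      (∏ j ∈ (insert s S)ᶜ, y j (x j) ^ (2 * q j)) * u (x s) ^ (2 * q s) := by
  rw [Finset.compl_insert, ← Finset.prod_erase_mul _ _ (Finset.mem_compl.2 hs)]
  congr 1
  · refine Finset.prod_congr rfl fun j hj => ?_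
    rw [Function.update_of_ne (Finset.ne_of_mem_erase hj)]
  · rw [Function.update_self]

/-- A family of nonnegative weights on `Fin n`, each of total mass at most one. -/
def IsWeight {m n : ℕ} (y : Fin m → Fin n → ℝ) : Prop :=
  (∀ j i, 0 ≤ y j i) ∧ ∀ j, ∑ i, y j i ≤ 1

theorem IsWeight.update {m n : ℕ} {y : Fin m → Fin n → ℝ} (hy : IsWeight y) (s : Fin m)
    {u : Fin n → ℝ} (hu : ∀ i, 0 ≤ u i) (hu1 : ∑ i, u i ≤ 1) :
    IsWeight (Function.update y s u) := by
  constructor <;> intro j <;> rcases eq_or_ne j s with rfl | h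
  · simpa using hu
  · simpa [h] using hy.1 j
  · simpa using hu1
  · simpa [h] using hy.2 j

theorem weighted_self_step {m n : ℕ} (q : Fin m → ℝ) (hq : ∀ j, 0 ≤ q j)
    (b : (Fin m → Fin n) → ℝ) (hb : ∀ x, 0 ≤ b x) (C : ℝ) (hC : 0 ≤ C)
    (S : Finset (Fin m)) (s : Fin m) (hs : s ∉ S) (hS : ∑ j ∈ insert s S, q j < 1)
    (h : ∀ y, IsWeight y →
      ∑ i, (∑ x with x s = i, b x * ∏ j ∈ Sᶜ, y j (x j) ^ (2 * q j)) ^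
        (1 / (2 * (1 - ∑ j ∈ S, q j))) ≤ C ^ (1 / (1 - ∑ j ∈ S, q j)))
    (y : Fin m → Fin n → ℝ) (hy : IsWeight y) :
    ∑ i, (∑ x with x s = i, b x * ∏ j ∈ (insert s S)ᶜ, y j (x j) ^ (2 * q j)) ^
        (1 / (2 * (1 - ∑ j ∈ insert s S, q j))) ≤ C ^ (1 / (1 - ∑ j ∈ insert s S, q j)) := by
  refine sum_fiber_rpow_le_of_forall_weight (fun x : Fin m → Fin n => x s) _
    (fun x => mul_nonneg (hb x) (Finset.prod_nonneg fun j _ => Real.rpow_nonneg (hy.1 _ _) _))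
    _ (q s) C (by linarith) (hq s) hC fun u hu hu1 => ?_
  have := h _ (hy.update s hu hu1)
  simp only [weight_mul_update q S s hs] at this
  have e : 1 - ∑ j ∈ insert s S, q j + q s = 1 - ∑ j ∈ S, q j := by
    rw [Finset.sum_insert hs]; ring
  rw [e]
  simpa only [mul_assoc] using this

theorem weighted_bound {m n : ℕ} (q : Fin m → ℝ) (hq : ∀ j, 0 ≤ q j)
    (b : (Fin m → Fin n) → ℝ) (hb : ∀ x, 0 ≤ b x) (C : ℝ) (hC : 0 ≤ C)
    (h : ∀ k y, IsWeight y → ∑ i, √(∑ x with x k = i, b x * ∏ j, y j (x j) ^ (2 * q j)) ≤ C)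
    (S : Finset (Fin m)) (hS : ∑ j ∈ S, q j ≤ 1 / 2) (k : Fin m) (y : Fin m → Fin n → ℝ)
    (hy : IsWeight y) :
    ∑ i, (∑ x with x k = i, b x * ∏ j ∈ Sᶜ, y j (x j) ^ (2 * q j)) ^
        (1 / (2 * (1 - ∑ j ∈ S, q j))) ≤ C ^ (1 / (1 - ∑ j ∈ S, q j)) := by
  induction S using Finset.induction_on generalizing k y with
  | empty => simpa [Real.sqrt_eq_rpow] using h k y hy
  | insert s S hs ih =>
    have hS' : ∑ j ∈ S, q j ≤ 1 / 2 := by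
      rw [Finset.sum_insert hs] at hS
      linarith [hq s]
    have e : 1 - ∑ j ∈ insert s S, q j + q s = 1 - ∑ j ∈ S, q j := by
      rw [Finset.sum_insert hs]; ring
    refine sum_fiber_rpow_le (fun x : Fin m → Fin n => x k) (fun x => x s) _
      (fun x => mul_nonneg (hb x) (Finset.prod_nonneg fun j _ => Real.rpow_nonneg (hy.1 _ _) _))
      _ (q s) C (by linarith) (hq s) hC (fun u hu hu1 => ?_)
      (weighted_self_step q hq b hb C hC S s hs (by linarith) (ih hS' s) y hy)
    have := ih hS' k _ (hy.update s hu hu1)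
    simp only [weight_mul_update q S s hs] at this
    rw [e]
    simpa only [mul_assoc] using this

/-- **Proposition 4.1, scalar case (mixed `(ℓ_λ, ℓ_2)`-norm inequality).** There is a constant
`C_m ≥ 1`, depending only on `m`, such that whenever `p ∈ [1,∞]^m` satisfies `|1/p| < 1` and
`Σ_{k ≠ l} 1/p_k ≤ 1/2` for every `l`, setting `λ = 1/(1 - |1/p|)`, every `m`-linear form
`A : ℓ_{p₁}^n × ⋯ × ℓ_{p_m}^n → ℂ` satisfies, for every `k`,
`(Σ_{i_k} (Σ_{î_k} |A(e_{i₁},…,e_{i_m})|²)^{λ/2})^{1/λ} ≤ C_m ‖A‖`. -/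
theorem mixed_lambda_two_inequality (m : ℕ) (hm : 1 ≤ m) :
    ∃ C : ℝ, 1 ≤ C ∧
      ∀ (n : ℕ), 1 ≤ n →
      ∀ (p : Fin m → ℝ≥0∞) [∀ k, Fact (1 ≤ p k)],
        (∑ k, ((p k)⁻¹).toReal) < 1 →
        (∀ l : Fin m, ∑ k ∈ Finset.univ.filter (fun k => k ≠ l), ((p k)⁻¹).toReal ≤ 1 / 2) →
        ∀ A : ContinuousMultilinearMap ℂ (fun k => PiLp (p k) (fun _ : Fin n => ℂ)) ℂ,
        ∀ k : Fin m,
          (∑ i : Fin n,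
              (∑ is ∈ Finset.univ.filter (fun is : Fin m → Fin n => is k = i),
                  ‖A (fun j => lpUnit (p j) n (is j))‖ ^ 2) ^
                ((1 / (1 - ∑ k, ((p k)⁻¹).toReal)) / 2)) ^ (1 - ∑ k, ((p k)⁻¹).toReal) ≤
            C * ‖A‖ := by
  refine ⟨2 ^ m, one_le_pow₀ one_le_two, fun n _ p _ hp hl A k => ?_⟩
  have hlk := hl k
  rw [Finset.filter_ne' Finset.univ k] at hlk
  set q : Fin m → ℝ := fun j => ((p j)⁻¹).toReal with hq
  have hq0 : ∀ j, 0 ≤ q j := fun j => ENNReal.toReal_nonneg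
  have hC : 0 ≤ 2 ^ m * ‖A‖ := by positivity
  have hins : insert k (Finset.univ.erase k) = Finset.univ := Finset.insert_erase (Finset.mem_univ k)
  have hpos : 0 < 1 - ∑ j, q j := sub_pos.2 hp
  have hw : IsWeight fun (_ : Fin m) (_ : Fin n) => (0 : ℝ) := ⟨by simp, by simp⟩
  have key := weighted_self_step q hq0 (fun x => ‖A (fun j => lpUnit (p j) n (x j))‖ ^ 2)
    (fun x => by positivity) _ hC (Finset.univ.erase k) k (Finset.notMem_erase k _)
    (by rw [hins]; exact hp)
    (weighted_bound q hq0 _ (fun x => by positivity) _ hC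
      (fun k y hy => sum_sqrt_weighted_le p A k y hy.1 hy.2) _ hlk k) _ hw
  rw [hins] at key
  simp only [Finset.compl_univ, Finset.prod_empty, mul_one] at key
  have hd : 1 / (1 - ∑ j, q j) / 2 = 1 / (2 * (1 - ∑ j, q j)) := by rw [div_div, mul_comm]
  rw [hd]
  refine (Real.rpow_le_rpow (Finset.sum_nonneg fun i _ => by positivity) key hpos.le).trans_eq ?_
  rw [← Real.rpow_mul hC, one_div_mul_cancel hpos.ne', Real.rpow_one]
end

section
/- For every d ≥ 1 there is a constant C_d > 0 with the following property: for all n ≥ 1 and all p_1,…,p_d ∈ [1,∞], there exist signs ε : {1,…,n}^d → {−1, +1} such that the d-linear map A : ℓ_{p_1}^n × ⋯ × ℓ_{p_d}^n → ℂ defined by A(z^{(1)},…,z^{(d)}) = Σ_{i_1,…,i_d=1}^{n} ε(i_1,…,i_d) z^{(1)}_{i_1} ⋯ z^{(d)}_{i_d} satisfies ‖A‖ ≤ C_d · n^{1/2 + α(p_1) + ⋯ + α(p_d)}, where α(p) = 1/2 − 1/p if p ≥ 2 and α(p) = 0 if p < 2 (with α(∞) = 1/2). -/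
open scoped ENNReal NNReal

/-- The exponent `α(p)`: `α(p) = 1/2 - 1/p` if `p ≥ 2` (so `α(∞) = 1/2`), and `α(p) = 0`
if `p < 2`. -/
noncomputable def alphExp (p : ℝ≥0∞) : ℝ := if 2 ≤ p then 1 / 2 - (p⁻¹).toReal else 0

open Finset in
lemma sum_Icc_half_pow_natAbs_le (L : ℕ) :
    ∑ a ∈ Icc (-(L : ℤ)) L, (1 / 2 : ℝ) ^ a.natAbs ≤ 3 - 2 * (1 / 2) ^ L := by
  induction L with
  | zero => norm_num
  | succ L ih =>
    have h : Icc (-((L + 1 : ℕ) : ℤ)) ((L + 1 : ℕ) : ℤ)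
        = insert ((L : ℤ) + 1) (insert (-((L : ℤ) + 1)) (Icc (-(L : ℤ)) L)) := by
      ext a; simp only [mem_Icc, mem_insert]; omega
    rw [h, sum_insert (by simp only [mem_Icc, mem_insert]; omega),
      sum_insert (by simp only [mem_Icc]; omega)]
    have e : ((L : ℤ) + 1).natAbs = L + 1 := by omega
    have e' : (-((L : ℤ) + 1)).natAbs = L + 1 := by omega
    rw [e, e', pow_succ]
    linarith

open Finset in
/-- The number of lattice points in a Euclidean ball of radius `2 √n` in dimension `n`. -/
lemma card_lattice_points_le (n : ℕ) :
    #{m ∈ Fintype.piFinset fun _ : Fin n => Icc (-((4 * n : ℕ) : ℤ)) ((4 * n : ℕ) : ℤ) |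
      ∑ i, m i ^ 2 ≤ 4 * (n : ℤ)} ≤ 48 ^ n := by
  set P := Fintype.piFinset fun _ : Fin n => Icc (-((4 * n : ℕ) : ℤ)) ((4 * n : ℕ) : ℤ)
  have weight (m : Fin n → ℤ) (hm : ∑ i, m i ^ 2 ≤ 4 * (n : ℤ)) :
      (1 : ℝ) ≤ 2 ^ (4 * n) * ∏ i, (1 / 2 : ℝ) ^ (m i).natAbs := by
    have h : ∑ i, (m i).natAbs ≤ 4 * n := by
      zify
      refine (sum_le_sum fun i _ => ?_).trans hm
      rw [← sq_abs (m i)]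
      exact Int.le_self_sq |m i|
    rw [prod_pow_eq_pow_sum, one_div, inv_pow, ← div_eq_mul_inv, one_le_div (by positivity)]
    exact pow_le_pow_right₀ (by norm_num) h
  have key : (#{m ∈ P | ∑ i, m i ^ 2 ≤ 4 * (n : ℤ)} : ℝ) ≤ 48 ^ n := calc
    (#{m ∈ P | ∑ i, m i ^ 2 ≤ 4 * (n : ℤ)} : ℝ) = ∑ m ∈ P with ∑ i, m i ^ 2 ≤ 4 * (n : ℤ), 1
      := by simp
    _ ≤ ∑ m ∈ P with ∑ i, m i ^ 2 ≤ 4 * (n : ℤ), 2 ^ (4 * n) * ∏ i, (1 / 2 : ℝ) ^ (m i).natAbs :=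
      sum_le_sum fun m hm => weight m (mem_filter.1 hm).2
    _ ≤ ∑ m ∈ P, 2 ^ (4 * n) * ∏ i, (1 / 2 : ℝ) ^ (m i).natAbs :=
      sum_le_sum_of_subset_of_nonneg (filter_subset _ _) fun _ _ _ => by positivity
    _ = 2 ^ (4 * n) * (∑ a ∈ Icc (-((4 * n : ℕ) : ℤ)) ((4 * n : ℕ) : ℤ),
          (1 / 2 : ℝ) ^ a.natAbs) ^ n := by
      rw [← mul_sum, sum_prod_piFinset (Icc (-((4 * n : ℕ) : ℤ)) ((4 * n : ℕ) : ℤ))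
        (fun (_ : Fin n) a => (1 / 2 : ℝ) ^ a.natAbs)]
      simp
    _ ≤ 2 ^ (4 * n) * 3 ^ n := by
      gcongr
      exact (sum_Icc_half_pow_natAbs_le _).trans (by simp)
    _ = 48 ^ n := by rw [pow_mul, ← mul_pow]; norm_num
  exact_mod_cast key

lemma exists_int_abs_le_abs_sub_le_one (t : ℝ) : ∃ m : ℤ, |(m : ℝ)| ≤ |t| ∧ |t - m| ≤ 1 := by
  rcases le_total 0 t with ht | ht
  · refine ⟨⌊t⌋, ?_, ?_⟩
    · rw [abs_of_nonneg ht, abs_of_nonneg (by exact_mod_cast Int.floor_nonneg.2 ht)]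
      exact Int.floor_le t
    · rw [abs_le]; constructor <;> linarith [Int.floor_le t, Int.lt_floor_add_one t]
  · refine ⟨⌈t⌉, ?_, ?_⟩
    · have h : ((⌈t⌉ : ℤ) : ℝ) ≤ 0 := by exact_mod_cast Int.ceil_le.2 (by simpa using ht)
      rw [abs_of_nonpos ht, abs_of_nonpos h]
      linarith [Int.le_ceil t]
    · rw [abs_le]; constructor <;> linarith [Int.le_ceil t, Int.ceil_lt_add_one t]

open Finset in
/-- The Euclidean unit ball of dimension `n` has a `1/2`-net with at most `48 ^ n` points. -/
lemma exists_half_net_card_le (n : ℕ) (hn : 1 ≤ n) :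
    ∃ N : Finset (EuclideanSpace ℝ (Fin n)), #N ≤ 48 ^ n ∧ (∀ w ∈ N, ‖w‖ ≤ 1) ∧
      ∀ x : EuclideanSpace ℝ (Fin n), ‖x‖ ≤ 1 → ∃ w ∈ N, ‖x - w‖ ≤ 1 / 2 := by
  classical
  have hn0 : (0 : ℝ) < n := by exact_mod_cast hn
  have hs : 0 < √(n : ℝ) := Real.sqrt_pos.2 hn0
  have hss : √(n : ℝ) ^ 2 = n := Real.sq_sqrt hn0.le
  set r : ℝ := 2 * √n with hr
  have hr0 : 0 < r := by positivity
  have hr2 : r ^ 2 = 4 * n := by rw [hr, mul_pow, hss]; norm_num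
  refine ⟨({m ∈ Fintype.piFinset fun _ : Fin n => Icc (-((4 * n : ℕ) : ℤ)) ((4 * n : ℕ) : ℤ) |
      ∑ i, m i ^ 2 ≤ 4 * (n : ℤ)}).image fun m => WithLp.toLp 2 fun i => (m i : ℝ) / r,
      card_image_le.trans (card_lattice_points_le n), ?_, ?_⟩
  · intro w hw
    obtain ⟨m, hm, rfl⟩ := mem_image.1 hw
    have hm : (∑ i, (m i : ℝ) ^ 2) ≤ 4 * n := by exact_mod_cast (mem_filter.1 hm).2
    rw [← sq_le_one_iff₀ (norm_nonneg _), EuclideanSpace.real_norm_sq_eq]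
    simp only [div_pow]
    rw [← sum_div, hr2]
    exact div_le_one_of_le₀ hm (by positivity)
  · intro x hx
    have hx2 : ∑ i, x i ^ 2 ≤ 1 := by
      rw [← EuclideanSpace.real_norm_sq_eq]; exact pow_le_one₀ (norm_nonneg _) hx
    choose m hm1 hm2 using fun i => exists_int_abs_le_abs_sub_le_one (r * x i)
    have hsum : ∑ i, m i ^ 2 ≤ 4 * (n : ℤ) := by
      have : ∑ i, (m i : ℝ) ^ 2 ≤ 4 * n := calc
        ∑ i, (m i : ℝ) ^ 2 ≤ ∑ i, (r * x i) ^ 2 := sum_le_sum fun i _ => sq_le_sq.2 (hm1 i)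
        _ = 4 * n * ∑ i, x i ^ 2 := by simp only [mul_pow, hr2, mul_sum]
        _ ≤ 4 * n := mul_le_of_le_one_right (by positivity) hx2
      exact_mod_cast this
    refine ⟨_, mem_image_of_mem _ (mem_filter.2 ⟨?_, hsum⟩), ?_⟩
    · refine Fintype.mem_piFinset.2 fun i => mem_Icc.2 (abs_le.1 ?_)
      calc |m i| ≤ m i ^ 2 := by rw [← sq_abs]; exact Int.le_self_sq _
        _ ≤ ∑ i, m i ^ 2 :=
          single_le_sum (f := fun i => m i ^ 2) (fun i _ => sq_nonneg _) (mem_univ i)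
        _ ≤ _ := by push_cast; exact hsum
    · refine abs_le_of_sq_le_sq' ?_ (by norm_num) |>.2
      rw [EuclideanSpace.real_norm_sq_eq]
      calc ∑ i, ((x - WithLp.toLp 2 fun i => (m i : ℝ) / r) i) ^ 2
          = ∑ i, (r * x i - m i) ^ 2 / r ^ 2 := by
            refine sum_congr rfl fun i _ => ?_
            simp only [PiLp.sub_apply]
            field_simp
        _ ≤ ∑ _i : Fin n, 1 / r ^ 2 := by
            gcongr with i
            exact (sq_le_one_iff_abs_le_one _).2 (hm2 i)
        _ = (1 / 2) ^ 2 := by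
            rw [hr2]; simp; field_simp; norm_num

/-- The inclusion of real into complex Euclidean space. -/
noncomputable def EuclideanSpace.complexify {ι : Type*} :
    EuclideanSpace ℝ ι →ₗ[ℝ] EuclideanSpace ℂ ι where
  toFun x := WithLp.toLp 2 fun i => (x i : ℂ)
  map_add' x y := by ext; simp
  map_smul' c x := by ext; simp

@[simp]
lemma EuclideanSpace.complexify_apply {ι : Type*} (x : EuclideanSpace ℝ ι) (i : ι) :
    EuclideanSpace.complexify x i = x i := rfl

/-- A linear map is controlled by its values on a `1/2`-net of the unit ball. -/
lemma LinearMap.norm_le_of_half_net {E F : Type*} [NormedAddCommGroup E] [NormedSpace ℝ E]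
    [FiniteDimensional ℝ E] [NormedAddCommGroup F] [NormedSpace ℝ F] {N : Set E}
    (hN : ∀ x : E, ‖x‖ ≤ 1 → ∃ w ∈ N, ‖x - w‖ ≤ 1 / 2) (φ : E →ₗ[ℝ] F) {T : ℝ}
    (hT : ∀ w ∈ N, ‖φ w‖ ≤ T) (x : E) : ‖φ x‖ ≤ 2 * T * ‖x‖ := by
  have hT0 : 0 ≤ T := by
    obtain ⟨w, hw, -⟩ := hN 0 (by simp)
    exact (norm_nonneg _).trans (hT w hw)
  set ψ := LinearMap.toContinuousLinearMap φ
  have h : ‖ψ‖ ≤ T + ‖ψ‖ * (1 / 2) := by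
    refine ContinuousLinearMap.opNorm_le_of_unit_norm (by positivity) fun x hx => ?_
    obtain ⟨w, hw, hxw⟩ := hN x hx.le
    calc ‖ψ x‖ = ‖ψ w + ψ (x - w)‖ := by rw [← map_add, add_sub_cancel]
      _ ≤ ‖ψ w‖ + ‖ψ (x - w)‖ := norm_add_le _ _
      _ ≤ T + ‖ψ‖ * (1 / 2) := add_le_add (hT w hw) (ψ.le_opNorm_of_le hxw)
  exact ψ.le_of_opNorm_le (by linarith) x

lemma LinearMap.norm_le_of_complexify_half_net {ι : Type*} [Fintype ι]
    {N : Set (EuclideanSpace ℝ ι)}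
    (hN : ∀ x : EuclideanSpace ℝ ι, ‖x‖ ≤ 1 → ∃ w ∈ N, ‖x - w‖ ≤ 1 / 2)
    (φ : EuclideanSpace ℂ ι →ₗ[ℂ] ℂ) {T : ℝ}
    (hT : ∀ w ∈ N, ‖φ (EuclideanSpace.complexify w)‖ ≤ T) (z : EuclideanSpace ℂ ι) :
    ‖φ z‖ ≤ 4 * T * ‖z‖ := by
  have hT0 : 0 ≤ T := by
    obtain ⟨w, hw, -⟩ := hN 0 (by simp)
    exact (norm_nonneg _).trans (hT w hw)
  have hreal := LinearMap.norm_le_of_half_net hN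
    ((φ.restrictScalars ℝ).comp EuclideanSpace.complexify) hT
  simp only [LinearMap.comp_apply, LinearMap.restrictScalars_apply] at hreal
  set x : EuclideanSpace ℝ ι := WithLp.toLp 2 fun i => (z i).re
  set y : EuclideanSpace ℝ ι := WithLp.toLp 2 fun i => (z i).im
  have hz : z = EuclideanSpace.complexify x + Complex.I • EuclideanSpace.complexify y := by
    ext i
    simp [x, y, mul_comm Complex.I, Complex.re_add_im]
  have hx : ‖x‖ ≤ ‖z‖ := by
    rw [EuclideanSpace.norm_eq, EuclideanSpace.norm_eq]
    gcongr with i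
    exact Complex.abs_re_le_norm _
  have hy : ‖y‖ ≤ ‖z‖ := by
    rw [EuclideanSpace.norm_eq, EuclideanSpace.norm_eq]
    gcongr with i
    exact Complex.abs_im_le_norm _
  calc ‖φ z‖ = ‖φ (EuclideanSpace.complexify x) +
        Complex.I * φ (EuclideanSpace.complexify y)‖ := by
        conv_lhs => rw [hz, map_add, map_smul, smul_eq_mul]
    _ ≤ ‖φ (EuclideanSpace.complexify x)‖ + ‖φ (EuclideanSpace.complexify y)‖ := by
        refine (norm_add_le _ _).trans ?_
        simp
    _ ≤ 2 * T * ‖z‖ + 2 * T * ‖z‖ := by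
        refine add_le_add ((hreal x).trans ?_) ((hreal y).trans ?_) <;> gcongr
    _ = 4 * T * ‖z‖ := by ring

/-- A multilinear form is controlled by its values on a product of `1/2`-nets. -/
lemma MultilinearMap.norm_le_of_complexify_half_net {κ ι : Type*} [Fintype κ] [Fintype ι]
    {N : Set (EuclideanSpace ℝ ι)}
    (hN : ∀ x : EuclideanSpace ℝ ι, ‖x‖ ≤ 1 → ∃ w ∈ N, ‖x - w‖ ≤ 1 / 2)
    (A : MultilinearMap ℂ (fun _ : κ => EuclideanSpace ℂ ι) ℂ) {T : ℝ}
    (hT : ∀ w : κ → EuclideanSpace ℝ ι, (∀ k, w k ∈ N) →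
      ‖A fun k => EuclideanSpace.complexify (w k)‖ ≤ T)
    (z : κ → EuclideanSpace ℂ ι) :
    ‖A z‖ ≤ 4 ^ Fintype.card κ * T * ∏ k, ‖z k‖ := by
  classical
  have key (s : Finset κ) : ∀ z : κ → EuclideanSpace ℂ ι,
      (∀ k ∉ s, z k ∈ EuclideanSpace.complexify '' N) →
        ‖A z‖ ≤ 4 ^ s.card * T * ∏ k ∈ s, ‖z k‖ := by
    induction s using Finset.induction with
    | empty =>
      intro z hz
      choose w hw hwz using fun k => hz k (by simp)
      simpa [hwz] using hT w hw
    | insert a s ha ih =>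
      intro z hz
      have h := LinearMap.norm_le_of_complexify_half_net hN (A.toLinearMap z a)
        (T := 4 ^ s.card * T * ∏ k ∈ s, ‖z k‖) (fun w hw => by
          refine (ih (Function.update z a (EuclideanSpace.complexify w)) fun k hk => ?_).trans_eq ?_
          · by_cases hka : k = a
            · subst hka; simpa using ⟨w, hw, rfl⟩
            · rw [Function.update_of_ne hka]
              exact hz k (by simp [hka, hk])
          · congr 1
            refine Finset.prod_congr rfl fun k hk => ?_
            rw [Function.update_of_ne (ne_of_mem_of_not_mem hk ha)]) (z a)
      rw [MultilinearMap.toLinearMap_apply, Function.update_eq_self] at h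
      refine h.trans_eq ?_
      rw [Finset.card_insert_of_notMem ha, Finset.prod_insert ha]
      ring
  simpa using key Finset.univ z (by simp)

open Finset in
lemma sum_signs_exp_le {ι : Type*} [Fintype ι] [DecidableEq ι] (a : ι → ℝ)
    (ha : ∑ i, a i ^ 2 ≤ 1) (t : ℝ) :
    ∑ ε ∈ Fintype.piFinset fun _ : ι => ({1, -1} : Finset ℝ), Real.exp (t * ∑ i, ε i * a i)
      ≤ 2 ^ Fintype.card ι * Real.exp (t ^ 2 / 2) := by
  calc ∑ ε ∈ Fintype.piFinset fun _ : ι => ({1, -1} : Finset ℝ), Real.exp (t * ∑ i, ε i * a i)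
      = ∏ i, ∑ e ∈ ({1, -1} : Finset ℝ), Real.exp (t * (e * a i)) := by
        rw [← sum_prod_piFinset ({1, -1} : Finset ℝ) fun i e => Real.exp (t * (e * a i))]
        simp only [mul_sum, Real.exp_sum]
    _ = ∏ i, 2 * Real.cosh (t * a i) := by
        refine prod_congr rfl fun i _ => ?_
        rw [sum_pair (by norm_num), Real.cosh_eq]
        ring_nf
    _ ≤ ∏ i, 2 * Real.exp ((t * a i) ^ 2 / 2) := by
        gcongr with i
        exact Real.cosh_le_exp_half_sq _
    _ = 2 ^ Fintype.card ι * Real.exp (t ^ 2 / 2 * ∑ i, a i ^ 2) := by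
        rw [prod_mul_distrib, ← Real.exp_sum, mul_sum]
        simp only [prod_const, card_univ]
        congr 2
        exact sum_congr rfl fun i _ => by ring
    _ ≤ 2 ^ Fintype.card ι * Real.exp (t ^ 2 / 2) := by
        gcongr
        exact mul_le_of_le_one_right (by positivity) ha

open Finset in
/-- Some choice of signs makes finitely many signed sums small simultaneously. -/
lemma exists_signs_exp_abs_le {ι J : Type*} [Fintype ι] [DecidableEq ι] (s : Finset J)
    (a : J → ι → ℝ) (ha : ∀ j ∈ s, ∑ i, a j i ^ 2 ≤ 1) (t : ℝ) :
    ∃ ε : ι → ℝ, (∀ i, ε i = 1 ∨ ε i = -1) ∧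
      ∀ j ∈ s, Real.exp (t * |∑ i, ε i * a j i|) ≤ 2 * #s * Real.exp (t ^ 2 / 2) := by
  set P := Fintype.piFinset fun _ : ι => ({1, -1} : Finset ℝ)
  have hP : #P = 2 ^ Fintype.card ι := by
    rw [show #P = _ from Fintype.card_piFinset _, prod_const, card_pair (by norm_num), card_univ]
  have hPne : P.Nonempty := by rw [← card_pos, hP]; positivity
  let F (ε : ι → ℝ) (j : J) : ℝ :=
    Real.exp (t * ∑ i, ε i * a j i) + Real.exp (-t * ∑ i, ε i * a j i)
  obtain ⟨ε, hε, hle⟩ : ∃ ε ∈ P, ∑ j ∈ s, F ε j ≤ 2 * #s * Real.exp (t ^ 2 / 2) := by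
    refine exists_le_of_sum_le hPne ?_
    rw [sum_comm, sum_const, hP]
    calc ∑ j ∈ s, ∑ ε ∈ P, F ε j
        ≤ ∑ _j ∈ s, 2 * (2 ^ Fintype.card ι * Real.exp (t ^ 2 / 2)) := by
          refine sum_le_sum fun j hj => ?_
          rw [sum_add_distrib, two_mul]
          refine add_le_add (sum_signs_exp_le _ (ha j hj) t) ?_
          simpa using sum_signs_exp_le _ (ha j hj) (-t)
      _ = _ := by simp; ring
  refine ⟨ε, fun i => by simpa using Fintype.mem_piFinset.1 hε i, fun j hj => ?_⟩
  refine le_trans ?_ ((single_le_sum (f := F ε) (fun j _ => by positivity) hj).trans hle)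
  rcases abs_cases (∑ i, ε i * a j i) with ⟨h, -⟩ | ⟨h, -⟩ <;> rw [h]
  · exact le_add_of_nonneg_right (Real.exp_nonneg _)
  · rw [mul_neg, ← neg_mul]; exact le_add_of_nonneg_left (Real.exp_nonneg _)

/-- The multilinear form with coefficients `ε` on a power of complex Euclidean space. -/
noncomputable def EuclideanSpace.formOfCoeffs {κ ι : Type*} [Fintype κ] [DecidableEq κ]
    [Fintype ι] (ε : (κ → ι) → ℝ) :
    MultilinearMap ℂ (fun _ : κ => EuclideanSpace ℂ ι) ℂ :=
  ∑ i : κ → ι, (ε i : ℂ) • (MultilinearMap.mkPiAlgebra ℂ κ ℂ).compLinearMap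
    fun k => (EuclideanSpace.proj (𝕜 := ℂ) (i k)).toLinearMap

lemma EuclideanSpace.formOfCoeffs_apply {κ ι : Type*} [Fintype κ] [DecidableEq κ]
    [Fintype ι] (ε : (κ → ι) → ℝ) (z : κ → EuclideanSpace ℂ ι) :
    EuclideanSpace.formOfCoeffs ε z = ∑ i : κ → ι, (ε i : ℂ) * ∏ k, z k (i k) := by
  simp [EuclideanSpace.formOfCoeffs]

open Finset in
/-- The case `p₁ = ⋯ = p_d = 2` of the Kahane–Salem–Zygmund inequality. -/
lemma exists_signs_norm_formOfCoeffs_le (d n : ℕ) (hn : 1 ≤ n) :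
    ∃ ε : (Fin d → Fin n) → ℝ, (∀ i, ε i = 1 ∨ ε i = -1) ∧
      ∀ z : Fin d → EuclideanSpace ℂ (Fin n), ‖EuclideanSpace.formOfCoeffs ε z‖ ≤
        4 ^ d * ((2 + d * Real.log 48) * √n) * ∏ k, ‖z k‖ := by
  classical
  have hn1 : (1 : ℝ) ≤ n := by exact_mod_cast hn
  have hs : 0 < √(n : ℝ) := Real.sqrt_pos.2 (by linarith)
  have hss : √(n : ℝ) * √n = n := Real.mul_self_sqrt (by linarith)
  obtain ⟨N, hNcard, hN1, hN⟩ := exists_half_net_card_le n hn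
  obtain ⟨ε, hε, hle⟩ := exists_signs_exp_abs_le
    (Fintype.piFinset fun _ : Fin d => N) (fun w (i : Fin d → Fin n) => ∏ k, w k (i k))
    (fun w hw => by
      simp only [← prod_pow]
      rw [← Fintype.piFinset_univ, sum_prod_piFinset univ fun k j => w k j ^ 2]
      refine prod_le_one (fun k _ => by positivity) fun k _ => ?_
      rw [← EuclideanSpace.real_norm_sq_eq]
      exact pow_le_one₀ (norm_nonneg _) (hN1 _ (Fintype.mem_piFinset.1 hw k))) √n
  refine ⟨ε, hε, fun z => ?_⟩
  have := MultilinearMap.norm_le_of_complexify_half_net (N := (N : Set _))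
    (by simpa using hN) (EuclideanSpace.formOfCoeffs ε) (T := (2 + d * Real.log 48) * √n)
    (fun w hw => by
      have hform : EuclideanSpace.formOfCoeffs ε (fun k => EuclideanSpace.complexify (w k))
          = ((∑ i, ε i * ∏ k, w k (i k) : ℝ) : ℂ) := by
        rw [EuclideanSpace.formOfCoeffs_apply]
        push_cast
        rfl
      rw [hform, Complex.norm_real, Real.norm_eq_abs]
      have h := hle w (Fintype.mem_piFinset.2 hw)
      set S := |∑ i, ε i * ∏ k, w k (i k)|
      have hcard : (#(Fintype.piFinset fun _ : Fin d => N) : ℝ) ≤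
          Real.exp (n * (d * Real.log 48)) := by
        rw [Fintype.card_piFinset_const]
        calc ((#N ^ d : ℕ) : ℝ) ≤ ((48 ^ n : ℕ) ^ d : ℕ) := by gcongr
          _ = Real.exp (n * (d * Real.log 48)) := by
            rw [← mul_assoc, mul_comm, Real.exp_mul, Real.exp_log (by norm_num)]
            rw [← pow_mul]
            exact_mod_cast (Real.rpow_natCast 48 (n * d)).symm
      have h2 : (2 : ℝ) ≤ Real.exp 1 := by linarith [Real.add_one_le_exp (1 : ℝ)]
      have hexp : Real.exp (√n * S) ≤ Real.exp (1 + n * (d * Real.log 48) + √n ^ 2 / 2) := by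
        rw [Real.exp_add, Real.exp_add]
        refine h.trans ?_
        gcongr
      have hlin := Real.exp_le_exp.1 hexp
      refine le_of_mul_le_mul_left (hlin.trans ?_) hs
      have hmul : √n * ((2 + d * Real.log 48) * √n) = n * (2 + d * Real.log 48) := by
        rw [mul_left_comm, hss, mul_comm]
      rw [hmul, sq, hss]
      linarith) z
  simpa using this

/-- Comparison of the `ℓ_2` norm with the `ℓ_p` norm on `ℂ^n`. -/
lemma PiLp.norm_toLp_two_le (n : ℕ) (hn : 1 ≤ n) (p : ℝ≥0∞) [Fact (1 ≤ p)]
    (z : PiLp p fun _ : Fin n => ℂ) :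
    ‖(WithLp.toLp 2 (WithLp.ofLp z) : EuclideanSpace ℂ (Fin n))‖ ≤
      (n : ℝ) ^ alphExp p * ‖z‖ := by
  have hn0 : (0 : ℝ) < n := by exact_mod_cast hn
  have hp1 : 1 ≤ p := Fact.out
  refine abs_le_of_sq_le_sq' ?_ (by positivity) |>.2
  rw [EuclideanSpace.norm_sq_eq, mul_pow]
  change ∑ i, ‖z i‖ ^ 2 ≤ _
  by_cases hp : p = ⊤
  · subst hp
    have : ((n : ℝ) ^ alphExp ⊤) ^ 2 = n := by
      rw [← Real.rpow_mul_natCast hn0.le]; simp [alphExp]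
    rw [this]
    calc ∑ i, ‖z i‖ ^ 2 ≤ ∑ _i : Fin n, ‖z‖ ^ 2 := by
          gcongr with i; exact PiLp.norm_apply_le z i
      _ = _ := by simp
  have hq1 : 1 ≤ p.toReal := by simpa using ENNReal.toReal_mono hp hp1
  set q := p.toReal with hq
  have hq0 : 0 < q := by linarith
  have hnorm : ‖z‖ ^ q = ∑ i, ‖z i‖ ^ q := by
    rw [PiLp.norm_eq_sum hq0, ← hq, ← Real.rpow_mul (by positivity), one_div,
      inv_mul_cancel₀ hq0.ne', Real.rpow_one]
  by_cases h2 : 2 ≤ p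
  · have hq2 : 2 ≤ q := by simpa using ENNReal.toReal_mono hp h2
    have hα : alphExp p = 1 / 2 - q⁻¹ := by simp [alphExp, h2, ENNReal.toReal_inv, hq]
    have h := Real.rpow_sum_le_const_mul_sum_rpow_of_nonneg Finset.univ
      (f := fun i => ‖z i‖ ^ 2) (p := q / 2) (by linarith) (fun i _ => by positivity)
    have e (x : ℝ) (hx : 0 ≤ x) : (x ^ 2) ^ (q / 2) = x ^ q := by
      rw [← Real.rpow_natCast_mul hx]; congr 1; push_cast; ring
    simp only [e _ (norm_nonneg _), ← hnorm, Finset.card_univ, Fintype.card_fin] at h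
    refine (Real.rpow_le_rpow_iff (by positivity) (by positivity)
      (show 0 < q / 2 by positivity)).1 (h.trans_eq ?_)
    rw [Real.mul_rpow (by positivity) (by positivity), e _ (norm_nonneg _),
      e _ (by positivity), ← Real.rpow_mul hn0.le, hα]
    congr 2
    field_simp
  · have hq2 : q ≤ 2 := by simpa using ENNReal.toReal_mono (by simp) (not_le.1 h2).le
    have hα : alphExp p = 0 := by simp [alphExp, h2]
    have split (x : ℝ) (hx : 0 ≤ x) : x ^ 2 = x ^ (2 - q) * x ^ q := by
      rw [← Real.rpow_add_of_nonneg hx (by linarith) hq0.le]; norm_num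
    rw [hα, Real.rpow_zero, one_pow, one_mul, split _ (norm_nonneg z), hnorm, Finset.mul_sum]
    refine Finset.sum_le_sum fun i _ => ?_
    rw [split _ (norm_nonneg _)]
    gcongr
    exact PiLp.norm_apply_le z i

/-- **Lemma 6.1 (Kahane–Salem–Zygmund-type inequality).** For every `d ≥ 1` there is `C_d > 0`
such that for all `n ≥ 1` and `p₁, …, p_d ∈ [1,∞]` there are signs `ε : {1,…,n}^d → {±1}` for
which the `d`-linear form `A(z⁽¹⁾,…,z⁽ᵈ⁾) = Σ_i ε(i) z⁽¹⁾_{i₁} ⋯ z⁽ᵈ⁾_{i_d}` on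
`ℓ_{p₁}^n × ⋯ × ℓ_{p_d}^n` satisfies `‖A‖ ≤ C_d n^{1/2 + α(p₁) + ⋯ + α(p_d)}`, i.e.
`|A(z)| ≤ C_d n^{1/2 + Σ_k α(p_k)} ∏_k ‖z⁽ᵏ⁾‖` for all `z`. -/
theorem kahane_salem_zygmund (d : ℕ) (hd : 1 ≤ d) :
    ∃ C : ℝ, 0 < C ∧
      ∀ (n : ℕ), 1 ≤ n →
      ∀ (p : Fin d → ℝ≥0∞) [∀ k, Fact (1 ≤ p k)],
        ∃ ε : (Fin d → Fin n) → ℝ,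
          (∀ i, ε i = 1 ∨ ε i = -1) ∧
          ∀ z : (k : Fin d) → PiLp (p k) (fun _ : Fin n => ℂ),
            ‖∑ i : Fin d → Fin n,
                (ε i : ℂ) * ∏ k, (WithLp.equiv (p k) (Fin n → ℂ)) (z k) (i k)‖ ≤
              C * (n : ℝ) ^ (1 / 2 + ∑ k, alphExp (p k)) * ∏ k, ‖z k‖ := by
  have hC : 0 < 2 + d * Real.log 48 := by
    have := Real.log_pos (show (1 : ℝ) < 48 by norm_num)
    positivity
  refine ⟨4 ^ d * (2 + d * Real.log 48), by positivity, fun n hn p _ => ?_⟩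
  have hn0 : (0 : ℝ) < n := by exact_mod_cast hn
  obtain ⟨ε, hε, hle⟩ := exists_signs_norm_formOfCoeffs_le d n hn
  refine ⟨ε, hε, fun z => ?_⟩
  have h := hle fun k => WithLp.toLp 2 (WithLp.ofLp (z k))
  rw [EuclideanSpace.formOfCoeffs_apply] at h
  refine h.trans ?_
  calc 4 ^ d * ((2 + d * Real.log 48) * √n) *
        ∏ k, ‖(WithLp.toLp 2 (WithLp.ofLp (z k)) : EuclideanSpace ℂ (Fin n))‖
      ≤ 4 ^ d * ((2 + d * Real.log 48) * √n) * ∏ k, (n : ℝ) ^ alphExp (p k) * ‖z k‖ := by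
        gcongr with k
        exact PiLp.norm_toLp_two_le n hn (p k) (z k)
    _ = _ := by
        rw [Finset.prod_mul_distrib, Real.rpow_add hn0, Real.rpow_sum_of_pos hn0,
          Real.sqrt_eq_rpow]
        ring
end

section
/- Let 1 ≤ p, q ≤ 2 with 1/p + 1/q ≤ 3/2. The constant 2^{1/p+1/q−1} is optimal in the inequality ( Σ_k ( Σ_j |A(e_k,e_j)|^q )^{p/q} )^{1/p} ≤ C‖A‖ for continuous bilinear forms A : c₀ × c₀ → ℝ. Concretely, the bilinear form A(x,y) = x_1 y_1 + x_1 y_2 + x_2 y_1 − x_2 y_2 satisfies ‖A‖ = 2 and ( Σ_{k=1}^{2} ( Σ_{j=1}^{2} |A(e_k,e_j)|^q )^{p/q} )^{1/p} = 2^{1/p+1/q} = 2^{1/p+1/q−1} ‖A‖; hence no constant C < 2^{1/p+1/q−1} can work. -/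
open scoped ENNReal NNReal

/-- The canonical unit vectors of `c₀`, the space of null sequences with the sup norm. -/
noncomputable def unitVec (𝕂 : Type*) [RCLike 𝕂] (i : ℕ) : ZeroAtInftyContinuousMap ℕ 𝕂 :=
  { toFun := fun j => if j = i then 1 else 0
    continuous_toFun := continuous_of_discreteTopology
    zero_at_infty' := by
      rw [Filter.cocompact_eq_cofinite]
      refine Filter.Tendsto.congr' ?_ tendsto_const_nhds
      filter_upwards [Filter.eventually_cofinite_ne i] with j hj
      simp [hj] }

theorem unitVec_apply (𝕂 : Type*) [RCLike 𝕂] (i j : ℕ) :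
    unitVec 𝕂 i j = if j = i then 1 else 0 := rfl

theorem ZeroAtInftyContinuousMap.norm_apply_le {α β : Type*} [TopologicalSpace α]
    [SeminormedAddCommGroup β] (f : ZeroAtInftyContinuousMap α β) (a : α) : ‖f a‖ ≤ ‖f‖ :=
  f.toBCF.norm_coe_le_norm a

theorem ZeroAtInftyContinuousMap.norm_le_of_forall {α β : Type*} [TopologicalSpace α]
    [SeminormedAddCommGroup β] {f : ZeroAtInftyContinuousMap α β} {C : ℝ} (hC : 0 ≤ C)
    (h : ∀ a, ‖f a‖ ≤ C) : ‖f‖ ≤ C :=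
  (BoundedContinuousFunction.norm_le (f := f.toBCF) hC).2 h

/-- The Littlewood form is bounded by twice the product of the sup norms. -/
theorem abs_littlewood_le {a b c d M N : ℝ} (ha : |a| ≤ M) (hb : |b| ≤ M) (hc : |c| ≤ N)
    (hd : |d| ≤ N) : |a * c + a * d + b * c - b * d| ≤ 2 * (M * N) := by
  have hM : 0 ≤ M := (abs_nonneg a).trans ha
  have h1 : |c + d| + |c - d| ≤ 2 * N := by
    rw [abs_le] at hc hd
    rcases abs_cases (c + d) with h | h <;> rcases abs_cases (c - d) with h' | h' <;> linarith
  calc |a * c + a * d + b * c - b * d| = |a * (c + d) + b * (c - d)| := by ring_nf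
    _ ≤ |a| * |c + d| + |b| * |c - d| := by
      simpa only [abs_mul] using abs_add_le (a * (c + d)) (b * (c - d))
    _ ≤ M * |c + d| + M * |c - d| := by gcongr
    _ = M * (|c + d| + |c - d|) := by ring
    _ ≤ M * (2 * N) := by gcongr
    _ = 2 * (M * N) := by ring

theorem norm_littlewood_eq_two
    (A : ContinuousMultilinearMap ℝ (fun _ : Fin 2 => ZeroAtInftyContinuousMap ℕ ℝ) ℝ)
    (hA : ∀ x y : ZeroAtInftyContinuousMap ℕ ℝ,
      A ![x, y] = x 0 * y 0 + x 0 * y 1 + x 1 * y 0 - x 1 * y 1) : ‖A‖ = 2 := by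
  apply le_antisymm
  · refine ContinuousMultilinearMap.opNorm_le_bound zero_le_two fun m => ?_
    have hm : m = ![m 0, m 1] := by
      ext i : 1
      fin_cases i <;> rfl
    rw [hm, hA, Fin.prod_univ_two, Real.norm_eq_abs]
    exact abs_littlewood_le ((m 0).norm_apply_le 0) ((m 0).norm_apply_le 1)
      ((m 1).norm_apply_le 0) ((m 1).norm_apply_le 1)
  · have hx : ‖unitVec ℝ 0 + unitVec ℝ 1‖ ≤ 1 := by
      refine ZeroAtInftyContinuousMap.norm_le_of_forall zero_le_one fun j => ?_
      rw [ZeroAtInftyContinuousMap.add_apply, unitVec_apply, unitVec_apply]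
      rcases j with _ | _ | j <;> simp
    have hy : ‖unitVec ℝ 0‖ ≤ 1 := by
      refine ZeroAtInftyContinuousMap.norm_le_of_forall zero_le_one fun j => ?_
      rw [unitVec_apply]
      split_ifs <;> simp
    have h := A.le_opNorm ![unitVec ℝ 0 + unitVec ℝ 1, unitVec ℝ 0]
    rw [hA, Fin.prod_univ_two] at h
    simp only [ZeroAtInftyContinuousMap.add_apply, unitVec_apply] at h
    norm_num at h
    exact h.trans (mul_le_of_le_one_right (norm_nonneg A) (mul_le_one₀ hx (norm_nonneg _) hy))

theorem nnnorm_littlewood_unitVec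
    (A : ContinuousMultilinearMap ℝ (fun _ : Fin 2 => ZeroAtInftyContinuousMap ℕ ℝ) ℝ)
    (hA : ∀ x y : ZeroAtInftyContinuousMap ℕ ℝ,
      A ![x, y] = x 0 * y 0 + x 0 * y 1 + x 1 * y 0 - x 1 * y 1) (k j : ℕ) :
    ‖A ![unitVec ℝ k, unitVec ℝ j]‖₊ = if k < 2 ∧ j < 2 then 1 else 0 := by
  rw [hA]
  simp only [unitVec_apply]
  rcases k with _ | _ | k <;> rcases j with _ | _ | j <;> simp

theorem tsum_ite_lt_two (a : ℝ≥0∞) : ∑' k : ℕ, (if k < 2 then a else 0) = 2 * a := by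
  rw [tsum_eq_sum (s := Finset.range 2) fun k hk => if_neg (by simpa using hk)]
  simp [Finset.sum_range_succ, two_mul]

theorem mixed_sum_littlewood {p q : ℝ} (hp : 0 < p) (hq : 0 < q)
    (A : ContinuousMultilinearMap ℝ (fun _ : Fin 2 => ZeroAtInftyContinuousMap ℕ ℝ) ℝ)
    (hA : ∀ x y : ZeroAtInftyContinuousMap ℕ ℝ,
      A ![x, y] = x 0 * y 0 + x 0 * y 1 + x 1 * y 0 - x 1 * y 1) :
    (∑' k : ℕ, (∑' j : ℕ,
        (‖A ![unitVec ℝ k, unitVec ℝ j]‖₊ : ℝ≥0∞) ^ q) ^ (p / q)) ^ (1 / p) =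
      ENNReal.ofReal (2 ^ (1 / p + 1 / q)) := by
  have hinner (k : ℕ) : (∑' j : ℕ, (‖A ![unitVec ℝ k, unitVec ℝ j]‖₊ : ℝ≥0∞) ^ q) ^ (p / q) =
      if k < 2 then 2 ^ (p / q) else 0 := by
    by_cases hk : k < 2
    · have (j : ℕ) : (‖A ![unitVec ℝ k, unitVec ℝ j]‖₊ : ℝ≥0∞) ^ q = if j < 2 then 1 else 0 := by
        rw [nnnorm_littlewood_unitVec A hA]
        by_cases hj : j < 2 <;> simp [hk, hj, hq]
      simp only [this, tsum_ite_lt_two, mul_one, if_pos hk]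
    · simp [nnnorm_littlewood_unitVec A hA, hk, hq, div_pos hp hq]
  simp only [hinner, tsum_ite_lt_two]
  rw [ENNReal.mul_rpow_of_nonneg _ _ (by positivity), ← ENNReal.rpow_mul,
    ← ENNReal.rpow_add _ _ two_ne_zero ENNReal.ofNat_ne_top,
    ← ENNReal.ofReal_rpow_of_pos two_pos, ENNReal.ofReal_ofNat]
  congr 2
  field_simp

/-- **Theorem 6.3, optimality (real case).** Let `1 ≤ p, q ≤ 2` with `1/p + 1/q ≤ 3/2`. The
bilinear form `A(x,y) = x₁y₁ + x₁y₂ + x₂y₁ - x₂y₂` on `c₀ × c₀` satisfies `‖A‖ = 2` and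
`(Σ_k (Σ_j |A(e_k,e_j)|^q)^{p/q})^{1/p} = 2^{1/p+1/q} = 2^{1/p+1/q-1}‖A‖`; consequently no
constant `C < 2^{1/p+1/q-1}` works in the inequality
`(Σ_k (Σ_j |B(e_k,e_j)|^q)^{p/q})^{1/p} ≤ C‖B‖`. -/
theorem bilinear_real_sharp_optimality (p q : ℝ)
    (hp1 : 1 ≤ p) (hp2 : p ≤ 2) (hq1 : 1 ≤ q) (hq2 : q ≤ 2)
    (hpq : 1 / p + 1 / q ≤ 3 / 2)
    (A : ContinuousMultilinearMap ℝ (fun _ : Fin 2 => ZeroAtInftyContinuousMap ℕ ℝ) ℝ)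
    (hA : ∀ x y : ZeroAtInftyContinuousMap ℕ ℝ,
      A ![x, y] = x 0 * y 0 + x 0 * y 1 + x 1 * y 0 - x 1 * y 1) :
    ‖A‖ = 2 ∧
    (∑' k : ℕ, (∑' j : ℕ,
        (‖A ![unitVec ℝ k, unitVec ℝ j]‖₊ : ℝ≥0∞) ^ q) ^ (p / q)) ^ (1 / p) =
      ENNReal.ofReal (2 ^ (1 / p + 1 / q)) ∧
    ∀ C : ℝ,
      (∀ B : ContinuousMultilinearMap ℝ (fun _ : Fin 2 => ZeroAtInftyContinuousMap ℕ ℝ) ℝ,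
        (∑' k : ℕ, (∑' j : ℕ,
            (‖B ![unitVec ℝ k, unitVec ℝ j]‖₊ : ℝ≥0∞) ^ q) ^ (p / q)) ^ (1 / p) ≤
          ENNReal.ofReal (C * ‖B‖)) →
      2 ^ (1 / p + 1 / q - 1) ≤ C := by
  have hnorm := norm_littlewood_eq_two A hA
  have hsum := mixed_sum_littlewood (zero_lt_one.trans_le hp1) (zero_lt_one.trans_le hq1) A hA
  refine ⟨hnorm, hsum, fun C hC => ?_⟩
  have h := hC A
  rw [hsum, hnorm, ENNReal.ofReal_le_ofReal_iff'] at h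
  have hpos : (0 : ℝ) < 2 ^ (1 / p + 1 / q) := by positivity
  rw [Real.rpow_sub_one two_ne_zero, div_le_iff₀ two_pos]
  exact h.resolve_right hpos.not_ge
end
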